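/- For every odd integer n ≥ 3 and every k ≥ 1, the chromatic quasisymmetric function X_{C_n}(x,t) of the labeled cycle C_n, regarded as a polynomial in t with coefficients symmetric polynomials in x_1,…,x_k, is e-unimodal and palindromic with center of symmetry n/2. -/

import Mathlib

open Finset MvPolynomial Polynomial

attribute [local instance] Classical.propDecidable

noncomputable section

/-- The descent number of a word `w = w₁⋯wₙ` over the alphabet `[k]`:
the number of indices `i ∈ [n-1]` with `wᵢ > wᵢ₊₁`. -/
def desc {n k : ℕ} (w : Fin n → Fin k) : ℕ :=
  (Finset.univ.filter fun i : Fin n =>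
    ∃ h : (i : ℕ) + 1 < n, w ⟨(i : ℕ) + 1, h⟩ < w i).card

/-- The cyclic descent number: the number of indices `i ∈ [n]` with `wᵢ > wᵢ₊₁`,
where `wₙ₊₁ := w₁`. -/
def cdesc {n k : ℕ} (w : Fin n → Fin k) : ℕ :=
  (Finset.univ.filter fun i : Fin n =>
    w ⟨((i : ℕ) + 1) % n, Nat.mod_lt _ i.pos⟩ < w i).card

/-- A word is Smirnov if no two adjacent letters are equal. -/
def IsSmirnov {n k : ℕ} (w : Fin n → Fin k) : Prop :=
  ∀ i : Fin n, ∀ h : (i : ℕ) + 1 < n, w ⟨(i : ℕ) + 1, h⟩ ≠ w i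

/-- the first letter is strictly smaller than the last letter -/
def FirstLtLast {n k : ℕ} (w : Fin n → Fin k) : Prop :=
  ∃ h : 0 < n, w ⟨0, h⟩ < w ⟨n - 1, Nat.sub_lt h Nat.one_pos⟩

/-- the first letter is strictly larger than the last letter -/
def FirstGtLast {n k : ℕ} (w : Fin n → Fin k) : Prop :=
  ∃ h : 0 < n, w ⟨n - 1, Nat.sub_lt h Nat.one_pos⟩ < w ⟨0, h⟩

/-- the first letter equals the last letter -/
def FirstEqLast {n k : ℕ} (w : Fin n → Fin k) : Prop :=
  ∃ h : 0 < n, w ⟨0, h⟩ = w ⟨n - 1, Nat.sub_lt h Nat.one_pos⟩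

/-- the first letter differs from the last letter -/
def FirstNeLast {n k : ℕ} (w : Fin n → Fin k) : Prop :=
  ∃ h : 0 < n, w ⟨0, h⟩ ≠ w ⟨n - 1, Nat.sub_lt h Nat.one_pos⟩

/-- the monomial `x_w = x_{w₁}⋯x_{wₙ}` -/
def xw (R : Type) [CommRing R] {n k : ℕ} (w : Fin n → Fin k) : MvPolynomial (Fin k) R :=
  ∏ i, MvPolynomial.X (w i)

/-- Generic restricted Smirnov word enumerator: the sum of `t^(stat w) · x_w` over all
Smirnov words `w` of length `n` over `[k]` satisfying `P`, as a polynomial in `t`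
with coefficients in `R[x₁,…,x_k]`. -/
def smirnovEnum (R : Type) [CommRing R] (n k : ℕ) (stat : (Fin n → Fin k) → ℕ)
    (P : (Fin n → Fin k) → Prop) : Polynomial (MvPolynomial (Fin k) R) :=
  ∑ w ∈ Finset.univ.filter (fun w : Fin n → Fin k => IsSmirnov w ∧ P w),
    Polynomial.X ^ stat w * Polynomial.C (xw R w)

/-- e-positivity of a symmetric polynomial in `x₁,…,x_k` (no `t`): it is a nonnegative
combination of products `e_λ = e_{λ₁}⋯e_{λ_ℓ}` over partitions `λ` (multisets of positive
integers). -/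
def EPosX (R : Type) [CommRing R] [PartialOrder R] {k : ℕ} (P : MvPolynomial (Fin k) R) : Prop :=
  ∃ (S : Finset (Multiset ℕ)) (c : Multiset ℕ → R),
    (∀ μ ∈ S, ∀ i ∈ μ, 0 < i) ∧ (∀ μ ∈ S, 0 ≤ c μ) ∧
    P = ∑ μ ∈ S, MvPolynomial.C (c μ) * (μ.map (esymm (Fin k) R)).prod

/-- e-positivity of a polynomial in `t` with coefficients in `R[x₁,…,x_k]`:
`P = Σ_λ c_λ(t) e_λ(x)` over partitions `λ`, where each `c_λ(t)` has nonnegative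
coefficients. -/
def EPosT (R : Type) [CommRing R] [PartialOrder R] {k : ℕ}
    (P : Polynomial (MvPolynomial (Fin k) R)) : Prop :=
  ∃ (S : Finset (Multiset ℕ)) (c : Multiset ℕ → Polynomial R),
    (∀ μ ∈ S, ∀ i ∈ μ, 0 < i) ∧ (∀ μ ∈ S, ∀ j, 0 ≤ (c μ).coeff j) ∧
    P = ∑ μ ∈ S, ((c μ).map (MvPolynomial.C : R →+* MvPolynomial (Fin k) R)) *
          Polynomial.C ((μ.map (esymm (Fin k) R)).prod)

/-- `P`, a polynomial in `t` with coefficients in `R[x₁,…,x_k]`, is symmetric in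
`x₁,…,x_k`. -/
def SymmX (R : Type) [CommRing R] {k : ℕ} (P : Polynomial (MvPolynomial (Fin k) R)) : Prop :=
  ∀ j : ℕ, (P.coeff j).IsSymmetric

/-- A polynomial `A = Σ_j a_j t^j` is palindromic with center of symmetry `m/2`:
`a_j = a_{m-j}` for all `j`, where coefficients with index outside `[0,m]` are `0`. -/
def PalinZ {R : Type} [CommRing R] (A : Polynomial R) (m : ℤ) : Prop :=
  ∀ j : ℕ, A.coeff j = if (j : ℤ) ≤ m then A.coeff (m - (j : ℤ)).toNat else 0

/-- e-unimodality of a polynomial in `t` with coefficients in `R[x₁,…,x_k]`: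
`0 ≤_e a_0 ≤_e a_1 ≤_e ⋯ ≤_e a_c ≥_e a_{c+1} ≥_e ⋯ ≥_e 0` for some `c`, where
`f ≤_e g` means `g - f` is e-positive. -/
def EUnimodal (R : Type) [CommRing R] [PartialOrder R] {k : ℕ}
    (A : Polynomial (MvPolynomial (Fin k) R)) : Prop :=
  EPosX R (A.coeff 0) ∧
  ∃ c : ℕ, (∀ j < c, EPosX R (A.coeff (j + 1) - A.coeff j)) ∧
    (∀ j, c ≤ j → EPosX R (A.coeff j - A.coeff (j + 1)))

/-- The descent number of a coloring of the labeled cycle `C_n`, whose edges are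
`{i, i+1}` for `i ∈ [n-1]` together with `{1, n}`: the number of edges `{i,j}` with
`i < j` and `κ(i) > κ(j)`. -/
def descCyc {n k : ℕ} (κ : Fin n → Fin k) : ℕ :=
  desc κ + (if FirstGtLast κ then 1 else 0)

/-- `κ` is a proper coloring of the labeled cycle `C_n`. -/
def ProperCyc {n k : ℕ} (κ : Fin n → Fin k) : Prop :=
  IsSmirnov κ ∧ FirstNeLast κ

/-- The chromatic quasisymmetric function `X_{C_n}(x,t)` of the labeled cycle `C_n`,
in the variables `x₁,…,x_k`, as a polynomial in `t` with coefficients in `R[x₁,…,x_k]`. -/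
def XCyc (R : Type) [CommRing R] (n k : ℕ) : Polynomial (MvPolynomial (Fin k) R) :=
  ∑ κ ∈ Finset.univ.filter (fun κ : Fin n → Fin k => ProperCyc κ),
    Polynomial.X ^ descCyc κ * Polynomial.C (xw R κ)

/-! ### Algebraic core: solving the transfer system -/

section Core

variable {S : Type} [CommRing S]

/-- transfer weight -/
def trw (t : S) (a b : ℕ) : S := if a < b then 1 else if b < a then t else 0

lemma trw_sum (t : S) (k b : ℕ) (hb : b < k) (f : ℕ → S) :
    ∑ c ∈ range k, trw t c b * f c =
      (∑ c ∈ range b, f c) + t * ((∑ c ∈ range k, f c) - ∑ c ∈ range (b + 1), f c) := by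
  rw [← Finset.sum_range_add_sum_Ico _ hb.le, ← Finset.sum_Ico_eq_sub _ hb,
    Finset.sum_eq_sum_Ico_succ_bot hb, Finset.mul_sum]
  congr 1
  · apply Finset.sum_congr rfl
    intro c hc
    simp [trw, Finset.mem_range.1 hc]
  · have : trw t b b = 0 := by simp [trw]
    rw [this, zero_mul, zero_add]
    apply Finset.sum_congr rfl
    intro c hc
    have h := (Finset.mem_Ico.1 hc).1
    have h1 : ¬ c < b := by omega
    have h2 : b < c := by omega
    simp [trw, h1, h2]

lemma trw_sum' (t : S) (k b : ℕ) (hb : b < k) (f : ℕ → S) :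
    ∑ c ∈ range k, trw t b c * f c =
      t * (∑ c ∈ range b, f c) + ((∑ c ∈ range k, f c) - ∑ c ∈ range (b + 1), f c) := by
  rw [← Finset.sum_range_add_sum_Ico _ hb.le, ← Finset.sum_Ico_eq_sub _ hb,
    Finset.sum_eq_sum_Ico_succ_bot hb, Finset.mul_sum]
  congr 1
  · apply Finset.sum_congr rfl
    intro c hc
    have h := Finset.mem_range.1 hc
    have h1 : ¬ b < c := by omega
    simp [trw, h, h1]
  · have : trw t b b = 0 := by simp [trw]
    rw [this, zero_mul, zero_add]
    apply Finset.sum_congr rfl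
    intro c hc
    have h := (Finset.mem_Ico.1 hc).1
    have h2 : b < c := by omega
    simp [trw, h2]

lemma core_row [IsDomain S] (t : S) (ht : 1 - t ≠ 0) (k a : ℕ) (ha : a < k) (y f : ℕ → S)
    (h1 : ∀ c, 1 + y c ≠ 0) (h2 : ∀ c, 1 + t * y c ≠ 0)
    (hf : ∀ b < k, f b = y b * ((if a = b then 1 else 0) + ∑ c ∈ range k, trw t c b * f c)) :
    ((∏ c ∈ range k, (1 + t * y c)) - t * ∏ c ∈ range k, (1 + y c)) *
        (∑ b ∈ range k, trw t a b * f b) =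
      (1 + t) * ((1 - t) * y a * (∏ c ∈ range a, (1 + t * y c)) * ∏ c ∈ Ico (a + 1) k, (1 + y c))
        - y a * ((∏ c ∈ range a, (1 + t * y c)) * ∏ c ∈ Ico (a + 1) k, (1 + t * y c))
        + t ^ 2 * (y a * ((∏ c ∈ range a, (1 + y c)) * ∏ c ∈ Ico (a + 1) k, (1 + y c))) := by
  set F := ∑ c ∈ range k, f c with hF
  let G : ℕ → S := fun b => (1 - t) * (∑ c ∈ range b, f c) + t * F
  have hstep : ∀ b < k, (1 + t * y b) * G (b + 1) =
      (1 + y b) * G b + (1 - t) * (if a = b then y b else 0) := by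
    intro b hb
    have h := hf b hb
    rw [trw_sum t k b hb, ← hF, Finset.sum_range_succ] at h
    simp only [G, Finset.sum_range_succ]
    split_ifs at h ⊢ with hab
    · linear_combination (1 - t) * h
    · linear_combination (1 - t) * h
  have hlow : ∀ b ≤ a, (∏ c ∈ range b, (1 + t * y c)) * G b =
      (∏ c ∈ range b, (1 + y c)) * (t * F) := by
    intro b
    induction b with
    | zero => intro _; simp [G]
    | succ b ih =>
      intro hb
      have h := hstep b (by omega)
      rw [if_neg (by omega)] at h
      have ih' := ih (by omega)
      rw [Finset.prod_range_succ, Finset.prod_range_succ]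
      linear_combination (∏ c ∈ range b, (1 + t * y c)) * h + (1 + y b) * ih'
  have hup : ∀ b, a + 1 ≤ b → b ≤ k → (∏ c ∈ Ico (a + 1) b, (1 + t * y c)) * G b =
      (∏ c ∈ Ico (a + 1) b, (1 + y c)) * G (a + 1) := by
    intro b hb
    induction b, hb using Nat.le_induction with
    | base => intro _; simp
    | succ b hb ih =>
      intro hbk
      have h := hstep b (by omega)
      rw [if_neg (by omega)] at h
      have ih' := ih (by omega)
      rw [Finset.prod_Ico_succ_top hb, Finset.prod_Ico_succ_top hb]
      linear_combination (∏ c ∈ Ico (a + 1) b, (1 + t * y c)) * h + (1 + y b) * ih'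
  have e1 := hlow a le_rfl
  have e2 := hup k ha le_rfl
  have e3 := hstep a ha
  rw [if_pos rfl] at e3
  have hGk : G k = F := by simp only [G, ← hF]; ring
  rw [hGk] at e2
  have hP : ∏ c ∈ range k, (1 + y c) =
      (∏ c ∈ range a, (1 + y c)) * ((1 + y a) * ∏ c ∈ Ico (a + 1) k, (1 + y c)) := by
    rw [← Finset.prod_range_mul_prod_Ico _ ha.le, Finset.prod_eq_prod_Ico_succ_bot ha]
  have hQ : ∏ c ∈ range k, (1 + t * y c) =
      (∏ c ∈ range a, (1 + t * y c)) * ((1 + t * y a) * ∏ c ∈ Ico (a + 1) k, (1 + t * y c)) := by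
    rw [← Finset.prod_range_mul_prod_Ico _ ha.le, Finset.prod_eq_prod_Ico_succ_bot ha]
  have np' : ∏ c ∈ Ico (a + 1) k, (1 + y c) ≠ 0 := Finset.prod_ne_zero_iff.2 fun c _ => h1 c
  have nq : ∏ c ∈ range a, (1 + t * y c) ≠ 0 := Finset.prod_ne_zero_iff.2 fun c _ => h2 c
  have hX : (1 - t) * (∑ b ∈ range k, trw t a b * f b) =
      (1 - t ^ 2) * F - G (a + 1) + t * G a := by
    rw [trw_sum' t k a ha, ← hF]
    simp only [G]
    ring
  rw [hP, hQ]
  generalize (∏ c ∈ range a, (1 + y c)) = p at *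
  generalize (∏ c ∈ range a, (1 + t * y c)) = q at *
  generalize (∏ c ∈ Ico (a + 1) k, (1 + y c)) = p' at *
  generalize (∏ c ∈ Ico (a + 1) k, (1 + t * y c)) = q' at *
  generalize G a = A at *
  generalize G (a + 1) = B at *
  generalize (∑ b ∈ range k, trw t a b * f b) = Xa at *
  set N := q * ((1 + t * y a) * q') - t * (p * ((1 + y a) * p')) with hN
  have hNF : N * F = p' * q * (1 - t) * y a := by
    rw [hN]
    linear_combination q * (1 + t * y a) * e2 + p' * q * e3 + (1 + y a) * p' * e1
  have hNB : N * B = (1 - t) * y a * q * q' := by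
    apply mul_left_cancel₀ np'
    linear_combination -N * e2 + q' * hNF
  have hNA : N * A = p * t * p' * (1 - t) * y a := by
    apply mul_left_cancel₀ nq
    linear_combination N * e1 + p * t * hNF
  apply mul_left_cancel₀ ht
  linear_combination N * hX + (1 - t ^ 2) * hNF - hNB + t * hNA

lemma core_tele (t : S) (k : ℕ) (y : ℕ → S) :
    ∑ a ∈ range k, (1 - t) * y a * (∏ c ∈ range a, (1 + t * y c)) *
        ∏ c ∈ Ico (a + 1) k, (1 + y c) =
      (∏ c ∈ range k, (1 + y c)) - ∏ c ∈ range k, (1 + t * y c) := by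
  have h := Finset.sum_range_sub'
    (fun j => (∏ c ∈ range j, (1 + t * y c)) * ∏ c ∈ Ico j k, (1 + y c)) k
  simp only [Finset.range_zero, Finset.prod_empty, one_mul, Finset.Ico_self, mul_one] at h
  rw [← Finset.range_eq_Ico] at h
  rw [← h]
  apply Finset.sum_congr rfl
  intro a ha
  rw [Finset.prod_eq_prod_Ico_succ_bot (Finset.mem_range.1 ha), Finset.prod_range_succ]
  ring

lemma prod_split_erase (k a : ℕ) (ha : a < k) (g : ℕ → S) :
    (∏ c ∈ range a, g c) * ∏ c ∈ Ico (a + 1) k, g c = ∏ c ∈ (range k).erase a, g c := by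
  rw [← Finset.prod_union]
  · apply Finset.prod_congr _ fun _ _ => rfl
    ext c
    simp only [Finset.mem_union, Finset.mem_range, Finset.mem_Ico, Finset.mem_erase]
    omega
  · rw [Finset.disjoint_left]
    intro c
    simp only [Finset.mem_range, Finset.mem_Ico]
    omega

lemma core_total [IsDomain S] (t : S) (ht : 1 - t ≠ 0) (k : ℕ) (y : ℕ → S) (f : ℕ → ℕ → S)
    (h1 : ∀ c, 1 + y c ≠ 0) (h2 : ∀ c, 1 + t * y c ≠ 0)
    (hf : ∀ a < k, ∀ b < k, f a b =
      y b * ((if a = b then 1 else 0) + ∑ c ∈ range k, trw t c b * f a c)) :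
    ((∏ c ∈ range k, (1 + t * y c)) - t * ∏ c ∈ range k, (1 + y c)) *
        (∑ a ∈ range k, ∑ b ∈ range k, trw t a b * f a b) =
      (1 + t) * ((∏ c ∈ range k, (1 + y c)) - ∏ c ∈ range k, (1 + t * y c))
        - (∑ a ∈ range k, y a * ∏ c ∈ (range k).erase a, (1 + t * y c))
        + t ^ 2 * ∑ a ∈ range k, y a * ∏ c ∈ (range k).erase a, (1 + y c) := by
  rw [← core_tele t k y, Finset.mul_sum, Finset.mul_sum, Finset.mul_sum, ← Finset.sum_sub_distrib,
    ← Finset.sum_add_distrib]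
  apply Finset.sum_congr rfl
  intro a ha
  have ha' := Finset.mem_range.1 ha
  rw [core_row t ht k a ha' y (f a) h1 h2 (hf a ha'), prod_split_erase k a ha',
    prod_split_erase k a ha']

end Core

/-! ### Elementary symmetric coefficients -/

section Elem

variable {R : Type} [CommRing R]

/-- elementary symmetric function of `x 0, …, x (k-1)` -/
def esm (k : ℕ) (x : ℕ → R) (i : ℕ) : R := ∑ s ∈ powersetCard i (range k), ∏ c ∈ s, x c

/-- the polynomial `∏ (1 + u x_c z)` -/
def epol (k : ℕ) (x : ℕ → R) (u : R) : Polynomial R :=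
  ∏ c ∈ range k, (1 + Polynomial.C (u * x c) * Polynomial.X)

lemma epol_coeff (k : ℕ) (x : ℕ → R) (u : R) (i : ℕ) :
    (epol k x u).coeff i = u ^ i * esm k x i := by
  rw [epol, Finset.prod_one_add, Polynomial.finsetSum_coeff, esm, Finset.powersetCard_eq_filter,
    Finset.sum_filter, Finset.mul_sum]
  apply Finset.sum_congr rfl
  intro s _
  rw [Finset.prod_mul_distrib, Finset.prod_const, ← map_prod, Polynomial.coeff_C_mul_X_pow,
    Finset.prod_mul_distrib, Finset.prod_const]
  by_cases h : #s = i
  · simp [h]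
  · simp [h, Ne.symm h]

lemma epol_der (k : ℕ) (x : ℕ → R) (u : R) (i : ℕ) :
    (∑ a ∈ range k, (Polynomial.C (u * x a) * Polynomial.X) *
      ∏ c ∈ (range k).erase a, (1 + Polynomial.C (u * x c) * Polynomial.X)).coeff i
      = i * (u ^ i * esm k x i) := by
  have : (∑ a ∈ range k, (Polynomial.C (u * x a) * Polynomial.X) *
      ∏ c ∈ (range k).erase a, (1 + Polynomial.C (u * x c) * Polynomial.X))
      = Polynomial.X * Polynomial.derivative (epol k x u) := by
    rw [epol, Polynomial.derivative_prod_finset, Finset.mul_sum]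
    apply Finset.sum_congr rfl
    intro a _
    simp
    ring
  rw [this]
  cases i with
  | zero => simp
  | succ i =>
    rw [Polynomial.coeff_X_mul, Polynomial.coeff_derivative, epol_coeff]
    push_cast
    ring

end Elem

/-! ### Transfer recursion for words -/

section Words

variable {R : Type} [CommRing R]

/-- weighted count of words of length `m+1` from `a` to `b` -/
def fw (t : R) (x : ℕ → R) (k : ℕ) : ℕ → ℕ → ℕ → R
  | 0, a, b => if a = b then x a else 0
  | m + 1, a, b => x b * ∑ c ∈ range k, trw t c b * fw t x k m a c

lemma words_sum (t : R) (x : ℕ → R) (k m : ℕ) (φ : ℕ → ℕ → R) :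
    ∑ w : Fin (m + 1) → Fin k, (∏ i : Fin m, trw t (w i.castSucc) (w i.succ)) *
        (∏ i, x (w i)) * φ (w 0) (w (Fin.last m)) =
      ∑ a ∈ range k, ∑ b ∈ range k, fw t x k m a b * φ a b := by
  induction m generalizing φ with
  | zero =>
    have : ∀ a ∈ range k, ∑ b ∈ range k, fw t x k 0 a b * φ a b = x a * φ a a := by
      intro a ha
      simp [fw, Finset.mem_range.1 ha]
    rw [Finset.sum_congr rfl this, Finset.sum_range]
    rw [← (Equiv.funUnique (Fin 1) (Fin k)).symm.sum_comp]
    simp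
  | succ m ih =>
    have key := ih (fun a c => ∑ b ∈ range k, trw t c b * x b * φ a b)
    have : ∑ a ∈ range k, ∑ b ∈ range k, fw t x k (m + 1) a b * φ a b =
        ∑ a ∈ range k, ∑ c ∈ range k, fw t x k m a c *
          ∑ b ∈ range k, trw t c b * x b * φ a b := by
      apply Finset.sum_congr rfl
      intro a _
      simp only [fw, Finset.mul_sum, Finset.sum_mul]
      rw [Finset.sum_comm]
      apply Finset.sum_congr rfl
      intro c _
      apply Finset.sum_congr rfl
      intro b _
      ring
    rw [this, ← key, ← (Fin.snocEquiv (fun _ => Fin k)).sum_comp, Fintype.sum_prod_type,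
      Finset.sum_comm]
    apply Finset.sum_congr rfl
    intro w _
    rw [Finset.sum_range, Finset.mul_sum]
    apply Finset.sum_congr rfl
    intro b _
    rw [Fin.prod_univ_castSucc, Fin.prod_univ_castSucc (n := m + 1)]
    have h0 : (Fin.snoc w b : Fin (m + 1 + 1) → Fin k) 0 = w 0 := by
      simp
    simp only [Fin.snocEquiv, Equiv.coe_fn_mk, Fin.snoc_last, Fin.snoc_castSucc, Fin.succ_last,
      Fin.succ_castSucc, h0]
    ring

/-- generating function for words from `a` to `b` -/
def fser (t : R) (x : ℕ → R) (k a b : ℕ) : PowerSeries R :=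
  PowerSeries.X * PowerSeries.mk (fun m => fw t x k m a b)

lemma trw_C (t : R) (a b : ℕ) : trw (PowerSeries.C t) a b = PowerSeries.C (trw t a b) := by
  unfold trw; split_ifs <;> simp

lemma fser_rec (t : R) (x : ℕ → R) (k a b : ℕ) :
    fser t x k a b = (PowerSeries.C (x b) * PowerSeries.X) * ((if a = b then 1 else 0) +
      ∑ c ∈ range k, trw (PowerSeries.C t) c b * fser t x k a c) := by
  have h : ∀ c, trw (PowerSeries.C t) c b * fser t x k a c =
    PowerSeries.X * (PowerSeries.C (trw t c b) * PowerSeries.mk (fun m => fw t x k m a c)) := by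
    intro c; rw [trw_C, fser]; ring
  simp only [h]
  rw [← Finset.mul_sum, fser, mul_comm (PowerSeries.C (x b)), mul_assoc]
  congr 1
  ext m
  cases m with
  | zero =>
    split_ifs with hab
    · simp [fw, hab]
    · simp [fw, hab]
  | succ m =>
    rw [PowerSeries.coeff_mk, PowerSeries.coeff_C_mul, map_add, PowerSeries.coeff_succ_X_mul,
      map_sum, fw]
    have : PowerSeries.coeff (m + 1) (if a = b then (1 : PowerSeries R) else 0) = 0 := by
      split_ifs <;> simp [PowerSeries.coeff_one]
    rw [this, zero_add]
    simp only [PowerSeries.coeff_C_mul, PowerSeries.coeff_mk]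

/-- number of closed words of length `n` -/
def cw (t : R) (x : ℕ → R) (k : ℕ) : ℕ → R
  | 0 => 0
  | m + 1 => ∑ a ∈ range k, ∑ b ∈ range k, trw t a b * fw t x k m a b

lemma cw_main [IsDomain R] (t : R) (ht : 1 - t ≠ 0) (x : ℕ → R) (k n : ℕ) :
    t * ∑ p ∈ antidiagonal n, (t ^ p.1 - t) * esm k x p.1 * cw t x k p.2 =
      t * (1 + t) * (1 - t ^ n) * esm k x n - n * t ^ n * esm k x n + t ^ 3 * n * esm k x n := by
  let T : PowerSeries R := PowerSeries.C t
  let y : ℕ → PowerSeries R := fun c => PowerSeries.C (x c) * PowerSeries.X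
  have hT : 1 - T ≠ 0 := by
    intro h
    have := congrArg PowerSeries.constantCoeff h
    simp [T] at this
    exact ht this
  have h1 : ∀ c, 1 + y c ≠ 0 := by
    intro c h
    have := congrArg PowerSeries.constantCoeff h
    simp [y] at this
  have h2 : ∀ c, 1 + T * y c ≠ 0 := by
    intro c h
    have := congrArg PowerSeries.constantCoeff h
    simp [y] at this
  have main := core_total T hT k y (fser t x k) h1 h2 (fun a _ b _ => fser_rec t x k a b)
  have eP : ∏ c ∈ range k, (1 + y c) = (epol k x 1 : PowerSeries R) := by
    rw [epol, ← Polynomial.coeToPowerSeries.ringHom_apply, map_prod]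
    simp [y]
  have eQ : ∏ c ∈ range k, (1 + T * y c) = (epol k x t : PowerSeries R) := by
    rw [epol, ← Polynomial.coeToPowerSeries.ringHom_apply, map_prod]
    simp [y, T, mul_assoc]
  have eX : ∑ a ∈ range k, ∑ b ∈ range k, trw T a b * fser t x k a b =
      PowerSeries.mk (cw t x k) := by
    ext m
    simp only [T, trw_C, map_sum, PowerSeries.coeff_C_mul, PowerSeries.coeff_mk, fser]
    cases m with
    | zero => simp [cw]
    | succ m => simp [cw, PowerSeries.coeff_succ_X_mul]
  have dP : ∑ a ∈ range k, y a * ∏ c ∈ (range k).erase a, (1 + y c) =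
      ((∑ a ∈ range k, (Polynomial.C (1 * x a) * Polynomial.X) *
      ∏ c ∈ (range k).erase a, (1 + Polynomial.C (1 * x c) * Polynomial.X) :
        Polynomial R) : PowerSeries R) := by
    rw [← Polynomial.coeToPowerSeries.ringHom_apply]
    simp only [map_sum, map_mul, map_prod, map_add, map_one]
    simp [y]
  have dQ : T * ∑ a ∈ range k, y a * ∏ c ∈ (range k).erase a, (1 + T * y c) =
      ((∑ a ∈ range k, (Polynomial.C (t * x a) * Polynomial.X) *
      ∏ c ∈ (range k).erase a, (1 + Polynomial.C (t * x c) * Polynomial.X) :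
        Polynomial R) : PowerSeries R) := by
    rw [← Polynomial.coeToPowerSeries.ringHom_apply, Finset.mul_sum]
    simp only [map_sum, map_mul, map_prod, map_add, map_one]
    simp [y, T, mul_assoc]
  rw [eX] at main
  have main2 := congrArg (fun z => PowerSeries.coeff n (T * z)) main
  rw [mul_add, mul_sub, dQ, dP, eP, eQ] at main2
  simp only [T, ← mul_assoc] at main2
  have r1 : PowerSeries.C t * (1 + PowerSeries.C t) = PowerSeries.C (t * (1 + t)) := by simp
  have r2 : PowerSeries.C t * PowerSeries.C t ^ 2 = PowerSeries.C (t * t ^ 2) := by simp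
  rw [r1, r2, mul_assoc, map_add, map_sub, PowerSeries.coeff_C_mul, PowerSeries.coeff_C_mul,
    PowerSeries.coeff_C_mul, Polynomial.coeff_coe, Polynomial.coeff_coe, epol_der, epol_der,
    map_sub, Polynomial.coeff_coe, Polynomial.coeff_coe, epol_coeff, epol_coeff,
    PowerSeries.coeff_mul] at main2
  simp only [map_sub, PowerSeries.coeff_C_mul, Polynomial.coeff_coe, epol_coeff,
    PowerSeries.coeff_mk, one_pow, one_mul] at main2
  have : ∑ p ∈ antidiagonal n, (t ^ p.1 - t) * esm k x p.1 * cw t x k p.2 =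
     ∑ p ∈ antidiagonal n, (t ^ p.1 * esm k x p.1 - t * esm k x p.1) * cw t x k p.2 := by
    apply Finset.sum_congr rfl
    intro p _
    ring
  rw [this, main2]
  ring

end Words

/-! ### The cone of e-positive, palindromic and unimodal polynomials -/

section Cone

variable {k : ℕ}

/-- product of elementary symmetric polynomials -/
def emon (k : ℕ) (μ : Multiset ℕ) : MvPolynomial (Fin k) ℤ := (μ.map (esymm (Fin k) ℤ)).prod

lemma eposX_zero : EPosX ℤ (0 : MvPolynomial (Fin k) ℤ) := ⟨∅, 0, by simp, by simp, by simp⟩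

lemma eposX_emon (μ : Multiset ℕ) (hμ : ∀ i ∈ μ, 0 < i) : EPosX ℤ (emon k μ) :=
  ⟨{μ}, 1, by simpa using hμ, by simp, by simp [emon]⟩

lemma eposX_add {p q : MvPolynomial (Fin k) ℤ} (hp : EPosX ℤ p) (hq : EPosX ℤ q) :
    EPosX ℤ (p + q) := by
  obtain ⟨S, c, h1, h2, rfl⟩ := hp
  obtain ⟨S', c', h1', h2', rfl⟩ := hq
  refine ⟨S ∪ S', fun μ => (if μ ∈ S then c μ else 0) + (if μ ∈ S' then c' μ else 0), ?_, ?_, ?_⟩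
  · intro μ hμ
    rcases Finset.mem_union.1 hμ with h | h
    · exact h1 μ h
    · exact h1' μ h
  · intro μ _
    apply add_nonneg
    · split_ifs with h
      · exact h2 μ h
      · exact le_rfl
    · split_ifs with h
      · exact h2' μ h
      · exact le_rfl
  · simp only [map_add, add_mul, Finset.sum_add_distrib]
    congr 1
    · rw [← Finset.sum_subset (Finset.subset_union_left (s₁ := S) (s₂ := S'))]
      · apply Finset.sum_congr rfl
        intro μ hμ
        rw [if_pos hμ]
      · intro μ _ hμ
        simp [hμ]
    · rw [← Finset.sum_subset (Finset.subset_union_right (s₁ := S) (s₂ := S'))]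
      · apply Finset.sum_congr rfl
        intro μ hμ
        rw [if_pos hμ]
      · intro μ _ hμ
        simp [hμ]

/-- the `t`-integer `[b]` -/
def tint (k b : ℕ) : Polynomial (MvPolynomial (Fin k) ℤ) := ∑ i ∈ range b, Polynomial.X ^ i

lemma tint_coeff (b j : ℕ) : (tint k b).coeff j = if j < b then 1 else 0 := by
  simp [tint, Polynomial.finsetSum_coeff, Polynomial.coeff_X_pow]

lemma tint_succ (b : ℕ) : tint k (b + 1) = tint k b + Polynomial.X ^ b :=
  Finset.sum_range_succ _ _

lemma tint_one_sub (b : ℕ) :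
    (1 - Polynomial.X) * tint k b = 1 - Polynomial.X ^ b := by
  induction b with
  | zero => simp [tint]
  | succ b ih => rw [tint_succ, mul_add, ih]; ring

lemma one_sub_ne : (1 - Polynomial.X : Polynomial (MvPolynomial (Fin k) ℤ)) ≠ 0 := by
  intro h
  have := congrArg (Polynomial.coeff · 0) h
  simp at this

lemma tint_mul (b c : ℕ) : tint k (b + 1) * tint k (c + 1) =
    tint k (b + c + 1) + Polynomial.X * (tint k b * tint k c) := by
  apply mul_left_cancel₀ one_sub_ne
  apply mul_left_cancel₀ one_sub_ne
  have h1 := tint_one_sub (k := k) (b + 1)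
  have h2 := tint_one_sub (k := k) (c + 1)
  have h3 := tint_one_sub (k := k) (b + c + 1)
  have h4 := tint_one_sub (k := k) b
  have h5 := tint_one_sub (k := k) c
  linear_combination (1 - Polynomial.X) * tint k (c + 1) * h1 + (1 - Polynomial.X ^ (b + 1)) * h2
    - (1 - Polynomial.X) * h3 - Polynomial.X * (1 - Polynomial.X) * tint k c * h4
    - Polynomial.X * (1 - Polynomial.X ^ b) * h5

/-- cone of sums of `t^a [b+1] e_μ` with `2a+b=m` -/
inductive UC (k m : ℕ) : Polynomial (MvPolynomial (Fin k) ℤ) → Prop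
  | zero : UC k m 0
  | add {p q} : UC k m p → UC k m q → UC k m (p + q)
  | basic (a b : ℕ) (μ : Multiset ℕ) (hμ : ∀ i ∈ μ, 0 < i) (h : 2 * a + b = m) :
      UC k m (Polynomial.X ^ a * tint k (b + 1) * Polynomial.C (emon k μ))

lemma UC.sum {m : ℕ} {ι : Type} (s : Finset ι) (f : ι → Polynomial (MvPolynomial (Fin k) ℤ))
    (h : ∀ i ∈ s, UC k m (f i)) : UC k m (∑ i ∈ s, f i) :=
  Finset.sum_induction f (UC k m) (fun _ _ => UC.add) UC.zero h

lemma UC.nsmul {m : ℕ} {p} (h : UC k m p) (n : ℕ) : UC k m (n * p) := by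
  induction n with
  | zero => simpa using UC.zero
  | succ n ih =>
    have : ((n + 1 : ℕ) : Polynomial (MvPolynomial (Fin k) ℤ)) * p = n * p + p := by
      push_cast; ring
    rw [this]
    exact ih.add h

lemma UC.basic_mul (μ : Multiset ℕ) (hμ : ∀ i ∈ μ, 0 < i) (b : ℕ) : ∀ (c a m : ℕ),
    2 * a + b + c = m →
    UC k m (Polynomial.X ^ a * (tint k (b + 1) * tint k (c + 1)) * Polynomial.C (emon k μ)) := by
  induction b with
  | zero =>
    intro c a m h
    have := UC.basic (k := k) (m := m) a c μ hμ (by omega)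
    simpa [tint] using this
  | succ b ih =>
    intro c a m h
    cases c with
    | zero =>
      have := UC.basic (k := k) (m := m) a (b + 1) μ hμ (by omega)
      simpa [tint] using this
    | succ c =>
      have h1 := UC.basic (k := k) (m := m) a (b + 1 + (c + 1)) μ hμ (by omega)
      have h2 := ih c (a + 1) m (by omega)
      rw [tint_mul (b + 1) (c + 1)]
      convert h1.add h2 using 1
      ring

lemma UC.mul_basic {m : ℕ} {p} (h : UC k m p) (a b i m' : ℕ) (hi : 0 < i)
    (hm : m' = m + 2 * a + b) :
    UC k m' (Polynomial.X ^ a * tint k (b + 1) * Polynomial.C (esymm (Fin k) ℤ i) * p) := by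
  induction h with
  | zero => simpa using UC.zero
  | add _ _ h1 h2 => rw [mul_add]; exact h1.add h2
  | basic a' b' μ hμ h =>
    have := UC.basic_mul (k := k) (i ::ₘ μ) (by
      intro j hj
      rcases Multiset.mem_cons.1 hj with rfl | h
      · exact hi
      · exact hμ j h) b b' (a + a') m' (by omega)
    convert this using 1
    simp only [emon, Multiset.map_cons, Multiset.prod_cons, map_mul]
    ring

lemma UC.mul_tint {m : ℕ} {p} (h : UC k m p) (a b m' : ℕ) (hm : m' = m + 2 * a + b) :
    UC k m' (Polynomial.X ^ a * tint k (b + 1) * p) := by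
  induction h with
  | zero => simpa using UC.zero
  | add _ _ h1 h2 => rw [mul_add]; exact h1.add h2
  | basic a' b' μ hμ h =>
    have := UC.basic_mul (k := k) μ hμ b b' (a + a') m' (by omega)
    convert this using 1
    ring

lemma basic_coeff (a b : ℕ) (f : MvPolynomial (Fin k) ℤ) (j : ℕ) :
    (Polynomial.X ^ a * tint k (b + 1) * Polynomial.C f).coeff j =
      if a ≤ j ∧ j ≤ a + b then f else 0 := by
  rw [Polynomial.coeff_mul_C, Polynomial.coeff_X_pow_mul', tint_coeff]
  by_cases h : a ≤ j
  · by_cases h' : j ≤ a + b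
    · rw [if_pos h, if_pos (by omega), if_pos ⟨h, h'⟩, one_mul]
    · rw [if_pos h, if_neg (by omega), if_neg (by omega), zero_mul]
  · rw [if_neg h, if_neg (by omega), zero_mul]

lemma UC.palin {m : ℕ} {p} (h : UC k m p) : PalinZ p (m : ℤ) := by
  intro j
  have hj : ((m : ℤ) - j).toNat = m - j := by omega
  have hj' : ((j : ℤ) ≤ m) = (j ≤ m) := by simp
  rw [hj]
  simp only [hj']
  induction h with
  | zero => simp
  | add _ _ h1 h2 =>
    rw [Polynomial.coeff_add, Polynomial.coeff_add, h1, h2]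
    split_ifs <;> simp
  | basic a b μ hμ h =>
    rw [basic_coeff, basic_coeff]
    by_cases h1 : a ≤ j ∧ j ≤ a + b
    · rw [if_pos h1, if_pos (by omega), if_pos (by omega)]
    · rw [if_neg h1]
      by_cases h2 : j ≤ m
      · rw [if_pos h2, if_neg (by omega)]
      · rw [if_neg h2]

lemma UC.coeff {m : ℕ} {p} (h : UC k m p) (j : ℕ) : EPosX ℤ (p.coeff j) := by
  induction h with
  | zero => simpa using eposX_zero
  | add _ _ h1 h2 => rw [Polynomial.coeff_add]; exact eposX_add h1 h2
  | basic a b μ hμ h =>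
    rw [basic_coeff]
    split_ifs
    · exact eposX_emon μ hμ
    · exact eposX_zero

lemma UC.up {m : ℕ} {p} (h : UC k m p) (j : ℕ) (hj : 2 * j + 2 ≤ m) :
    EPosX ℤ (p.coeff (j + 1) - p.coeff j) := by
  induction h with
  | zero => simpa using eposX_zero
  | add _ _ h1 h2 =>
    rw [Polynomial.coeff_add, Polynomial.coeff_add, add_sub_add_comm]
    exact eposX_add h1 h2
  | basic a b μ hμ h =>
    rw [basic_coeff, basic_coeff]
    by_cases h1 : a ≤ j ∧ j ≤ a + b
    · rw [if_pos h1, if_pos (by omega), sub_self]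
      exact eposX_zero
    · rw [if_neg h1, sub_zero]
      split_ifs
      · exact eposX_emon μ hμ
      · exact eposX_zero

lemma UC.down {m : ℕ} {p} (h : UC k m p) (j : ℕ) (hj : m ≤ 2 * j + 1) :
    EPosX ℤ (p.coeff j - p.coeff (j + 1)) := by
  induction h with
  | zero => simpa using eposX_zero
  | add _ _ h1 h2 =>
    rw [Polynomial.coeff_add, Polynomial.coeff_add, add_sub_add_comm]
    exact eposX_add h1 h2
  | basic a b μ hμ h =>
    rw [basic_coeff, basic_coeff]
    by_cases h1 : a ≤ j + 1 ∧ j + 1 ≤ a + b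
    · rw [if_pos h1, if_pos (by omega), sub_self]
      exact eposX_zero
    · rw [if_neg h1, sub_zero]
      split_ifs
      · exact eposX_emon μ hμ
      · exact eposX_zero

lemma UC.unimodal {m : ℕ} {p} (h : UC k m p) : EUnimodal ℤ p :=
  ⟨h.coeff 0, m / 2, fun j hj => h.up j (by omega), fun j hj => h.down j (by omega)⟩

/-- numerator polynomials -/
def pnum (k : ℕ) : ℕ → Polynomial (MvPolynomial (Fin k) ℤ)
  | 0 => 0
  | 1 => 0
  | 2 => 1 + Polynomial.X ^ 2
  | i + 3 => tint k (i + 4) + Polynomial.X * tint k (i + 2) +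
      ((i + 3 : ℕ) : Polynomial (MvPolynomial (Fin k) ℤ)) * (Polynomial.X ^ 2 * tint k i)

lemma pnum_eq (i : ℕ) : (1 - Polynomial.X) * (Polynomial.X * pnum k i) =
    Polynomial.X * (1 + Polynomial.X) * (1 - Polynomial.X ^ i)
      - (i : Polynomial (MvPolynomial (Fin k) ℤ)) * Polynomial.X ^ i
      + Polynomial.X ^ 3 * (i : Polynomial (MvPolynomial (Fin k) ℤ)) := by
  match i with
  | 0 => simp [pnum]
  | 1 => simp [pnum]; ring
  | 2 => simp [pnum]; ring
  | i + 3 =>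
    have h3 := tint_one_sub (k := k) (i + 4)
    have h4 := tint_one_sub (k := k) (i + 2)
    have h5 := tint_one_sub (k := k) i
    simp only [pnum]
    linear_combination Polynomial.X * h3 + Polynomial.X ^ 2 * h4
      + ((i + 3 : ℕ) : Polynomial (MvPolynomial (Fin k) ℤ)) * Polynomial.X ^ 3 * h5

lemma tint_zero : tint k 0 = 0 := by simp [tint]
lemma tint_one : tint k 1 = 1 := by simp [tint]

/-- base case of the cone: `p_i e_i`, `i ≥ 3` -/
lemma UC.pnum (i : ℕ) : UC k (i + 3)
    (pnum k (i + 3) * Polynomial.C (esymm (Fin k) ℤ (i + 3))) := by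
  have hμ : ∀ j ∈ ({i + 3} : Multiset ℕ), 0 < j := by simp
  have h1 := UC.basic (k := k) (m := i + 3) 0 (i + 3) {i + 3} hμ (by omega)
  have h2 := UC.basic (k := k) (m := i + 3) 1 (i + 1) {i + 3} hμ (by omega)
  have h3 : UC k (i + 3) (Polynomial.X ^ 2 * tint k i * Polynomial.C (emon k {i + 3})) := by
    cases i with
    | zero => simpa [tint] using UC.zero
    | succ i => exact UC.basic 2 i _ hμ (by omega)
  have h4 := (h1.add h2).add (h3.nsmul (i + 3))
  convert h4 using 1
  simp only [_root_.pnum, emon, Multiset.map_singleton, Multiset.prod_singleton]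
  ring

/-- `[2c] (1+t^2) e_2` is in the cone -/
lemma UC.pnum_two (c : ℕ) : UC k (2 * c + 3)
    (tint k (2 * c + 2) * (_root_.pnum k 2 * Polynomial.C (esymm (Fin k) ℤ 2))) := by
  have hμ : ∀ j ∈ ({2} : Multiset ℕ), 0 < j := by simp
  have h1 := UC.basic (k := k) (m := 2 * c + 3) 0 (2 * c + 3) {2} hμ (by omega)
  have h3 : UC k (2 * c + 3) (Polynomial.X ^ 2 * tint k (2 * c) * Polynomial.C (emon k {2})) := by
    cases c with
    | zero => simpa [tint] using UC.zero
    | succ c => exact UC.basic 2 (2 * c + 1) _ hμ (by omega)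
  convert h1.add h3 using 1
  simp only [_root_.pnum, emon, Multiset.map_singleton, Multiset.prod_singleton]
  have : tint k (2 * c + 2) * (1 + Polynomial.X ^ 2) =
      tint k (2 * c + 3 + 1) + Polynomial.X ^ 2 * tint k (2 * c) := by
    apply mul_left_cancel₀ one_sub_ne
    have h3 := tint_one_sub (k := k) (2 * c + 2)
    have h4 := tint_one_sub (k := k) (2 * c + 3 + 1)
    have h5 := tint_one_sub (k := k) (2 * c)
    linear_combination (1 + Polynomial.X ^ 2) * h3 - h4 - Polynomial.X ^ 2 * h5
  rw [← mul_assoc, this]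
  ring

/-- Main induction on the recursion. -/
lemma cone_rec (Z : ℕ → Polynomial (MvPolynomial (Fin k) ℤ))
    (hZ : ∀ n, Z n = pnum k n * Polynomial.C (esymm (Fin k) ℤ n) +
      ∑ i ∈ range (n - 1), Polynomial.X * tint k (i + 1) *
        Polynomial.C (esymm (Fin k) ℤ (i + 2)) * Z (n - (i + 2))) (n : ℕ) :
    (Odd n → UC k n (Z n)) ∧
    (∀ c, UC k (n + 2 * c + 1) (tint k (2 * c + 2) * Z n)) := by
  induction n using Nat.strong_induction_on with
  | _ n ih =>
  have key : Odd n → UC k n (Z n) := by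
    intro hodd
    rw [hZ]
    apply UC.add
    · match n, hodd with
      | 1, _ => simpa [pnum] using UC.zero
      | 2, h => exact absurd h (by decide)
      | i + 3, _ => exact UC.pnum i
    · apply UC.sum
      intro i hi
      have hi' := Finset.mem_range.1 hi
      have IH := ih (n - (i + 2)) (by omega)
      rcases Nat.even_or_odd i with he | ho
      · have : Odd (n - (i + 2)) := by
          obtain ⟨r, rfl⟩ := he
          obtain ⟨s, rfl⟩ := hodd
          exact ⟨s - r - 1, by omega⟩
        have := (IH.1 this).mul_basic 1 i (i + 2) n (by omega) (by omega)
        simpa using this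
      · obtain ⟨r, rfl⟩ := ho
        have h := (IH.2 r).mul_basic 1 0 (2 * r + 1 + 2) n (by omega) (by omega)
        convert h using 1
        simp only [zero_add, tint_one]
        ring
  refine ⟨key, ?_⟩
  intro c
  rcases Nat.even_or_odd n with he | ho
  swap
  · have := (key ho).mul_tint 0 (2 * c + 1) (n + 2 * c + 1) (by omega)
    simpa using this
  rw [hZ, mul_add]
  apply UC.add
  · match n, he with
    | 0, _ => simpa [pnum] using UC.zero
    | 1, h => exact absurd h (by decide)
    | 2, _ =>
      have := UC.pnum_two (k := k) c
      rwa [show 2 + 2 * c + 1 = 2 * c + 3 by omega]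
    | i + 3, _ =>
      have := (UC.pnum (k := k) i).mul_tint 0 (2 * c + 1) (i + 3 + 2 * c + 1) (by omega)
      simpa using this
  · rw [Finset.mul_sum]
    apply UC.sum
    intro i hi
    have hi' := Finset.mem_range.1 hi
    have IH := ih (n - (i + 2)) (by omega)
    have h := (IH.2 c).mul_basic 1 i (i + 2) (n + 2 * c + 1) (by omega) (by omega)
    convert h using 1
    ring

end Cone

/-! ### Linking the chromatic quasisymmetric function with the transfer recursion -/

section Link

/-- the variables, indexed by naturals -/
def xv (k : ℕ) (c : ℕ) : Polynomial (MvPolynomial (Fin k) ℤ) :=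
  if h : c < k then Polynomial.C (MvPolynomial.X ⟨c, h⟩) else 0

lemma xv_fin {k : ℕ} (c : Fin k) : xv k c = Polynomial.C (MvPolynomial.X c) := by
  simp [xv]

lemma esm_xv (k i : ℕ) : esm k (xv k) i = Polynomial.C (esymm (Fin k) ℤ i) := by
  have : range k = (univ : Finset (Fin k)).map Fin.valEmbedding := by
    ext c; simp
  rw [esm, this, Finset.powersetCard_map, Finset.sum_map, esymm, map_sum]
  apply Finset.sum_congr rfl
  intro s _
  simp [Finset.prod_map, xv_fin]

lemma term_eq {k m : ℕ} (w : Fin (m + 1) → Fin k) :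
    (if ProperCyc w then Polynomial.X ^ descCyc w * Polynomial.C (xw ℤ w) else 0) =
      (∏ i : Fin m, trw (Polynomial.X : Polynomial (MvPolynomial (Fin k) ℤ))
        (w i.castSucc) (w i.succ)) * (∏ i, xv k (w i)) *
        trw Polynomial.X (w 0) (w (Fin.last m)) := by
  have hx : ∏ i, xv k (w i) = Polynomial.C (xw ℤ w) := by
    rw [xw, map_prod]; simp only [xv_fin]
  rw [hx]
  have hS : IsSmirnov w ↔ ∀ i : Fin m, w i.succ ≠ w i.castSucc := by
    constructor
    · intro h i
      exact h i.castSucc (by simp)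
    · intro h i hi
      exact h ⟨i, by omega⟩
  have hN : FirstNeLast w ↔ w 0 ≠ w (Fin.last m) :=
    ⟨fun ⟨_, h⟩ => h, fun h => ⟨Nat.succ_pos m, h⟩⟩
  have hG : FirstGtLast w ↔ w (Fin.last m) < w 0 :=
    ⟨fun ⟨_, h⟩ => h, fun h => ⟨Nat.succ_pos m, h⟩⟩
  have hd : desc w = #{i : Fin m | w i.succ < w i.castSucc} := by
    rw [desc, ← Finset.card_map (Fin.castSuccEmb (n := m))]
    apply congrArg Finset.card
    ext i
    simp only [Finset.mem_filter, Finset.mem_univ, true_and, Finset.mem_map,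
      Fin.coe_castSuccEmb]
    constructor
    · rintro ⟨h, h'⟩
      exact ⟨⟨i, by omega⟩, h', rfl⟩
    · rintro ⟨j, h, rfl⟩
      exact ⟨by simp, h⟩
  by_cases hs : IsSmirnov w
  · have hprod : (∏ i : Fin m, trw (Polynomial.X : Polynomial (MvPolynomial (Fin k) ℤ))
        (w i.castSucc) (w i.succ)) = Polynomial.X ^ desc w := by
      rw [hd, ← Finset.prod_const, Finset.prod_filter]
      apply Finset.prod_congr rfl
      intro i _
      have hi := hS.1 hs i
      simp only [trw, Fin.val_fin_lt]
      rcases lt_or_gt_of_ne hi with h | h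
      · simp [h, not_lt.2 h.le]
      · simp [h, not_lt.2 h.le]
    rw [hprod]
    simp only [ProperCyc, hs, true_and, hN, descCyc, hG, trw, Fin.val_fin_lt]
    rcases lt_trichotomy (w 0) (w (Fin.last m)) with h | h | h
    · simp [h, h.ne, not_lt.2 h.le]
    · simp [h]
    · simp [h, h.ne', not_lt.2 h.le]
      ring
  · rw [if_neg (fun h => hs h.1)]
    rw [hS] at hs
    push Not at hs
    obtain ⟨i, hi⟩ := hs
    rw [Finset.prod_eq_zero (Finset.mem_univ i)]
    · simp
    · simp [trw, hi]

lemma XCyc_eq (n k : ℕ) (hn : 1 ≤ n) : XCyc ℤ n k = cw Polynomial.X (xv k) k n := by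
  obtain ⟨m, rfl⟩ : ∃ m, n = m + 1 := ⟨n - 1, by omega⟩
  rw [XCyc, Finset.sum_filter, cw]
  have := words_sum (Polynomial.X : Polynomial (MvPolynomial (Fin k) ℤ)) (xv k) k m
    (trw Polynomial.X)
  simp only [mul_comm (fw _ _ _ _ _ _)] at this
  rw [← this]
  apply Finset.sum_congr rfl
  intro w _
  exact term_eq w

lemma cw_one (k : ℕ) (t : Polynomial (MvPolynomial (Fin k) ℤ)) (x) : cw t x k 1 = 0 := by
  simp only [cw]
  apply Finset.sum_eq_zero
  intro a _
  apply Finset.sum_eq_zero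
  intro b _
  by_cases h : a = b
  · simp [trw, h]
  · simp [fw, h]

lemma cw_rec (k n : ℕ) : cw Polynomial.X (xv k) k n =
    pnum k n * Polynomial.C (esymm (Fin k) ℤ n) +
      ∑ i ∈ range (n - 1), Polynomial.X * tint k (i + 1) *
        Polynomial.C (esymm (Fin k) ℤ (i + 2)) * cw Polynomial.X (xv k) k (n - (i + 2)) := by
  match n with
  | 0 => simp [cw, pnum]
  | 1 => simp [cw_one, pnum]
  | n + 2 =>
  have h := cw_main (Polynomial.X : Polynomial (MvPolynomial (Fin k) ℤ)) one_sub_ne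
    (xv k) k (n + 2)
  simp only [esm_xv] at h
  rw [Finset.Nat.sum_antidiagonal_eq_sum_range_succ_mk, Finset.sum_range_succ',
    Finset.sum_range_succ'] at h
  have hp := pnum_eq (k := k) (n + 2)
  apply mul_left_cancel₀ one_sub_ne
  apply mul_left_cancel₀ (Polynomial.X_ne_zero (R := MvPolynomial (Fin k) ℤ))
  have hs : ∑ i ∈ range (n + 1), (Polynomial.X ^ (i + 1 + 1) - Polynomial.X) *
      Polynomial.C (esymm (Fin k) ℤ (i + 1 + 1)) *
      cw Polynomial.X (xv k) k (n + 2 - (i + 1 + 1)) =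
    - ((1 - Polynomial.X) * ∑ i ∈ range (n + 2 - 1), Polynomial.X * tint k (i + 1) *
        Polynomial.C (esymm (Fin k) ℤ (i + 2)) * cw Polynomial.X (xv k) k (n + 2 - (i + 2))) := by
    rw [Finset.mul_sum, ← Finset.sum_neg_distrib]
    apply Finset.sum_congr rfl
    intro i _
    have := tint_one_sub (k := k) (i + 1)
    linear_combination Polynomial.X * Polynomial.C (esymm (Fin k) ℤ (i + 2)) *
      cw Polynomial.X (xv k) k (n + 2 - (i + 2)) * this
  rw [hs] at h
  simp only [zero_add, pow_one, sub_self, zero_mul, add_zero, pow_zero, esymm_zero, map_one,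
    mul_one, Nat.sub_zero] at h
  linear_combination h - Polynomial.C (esymm (Fin k) ℤ (n + 2)) * hp

end Link

/-- For odd `n ≥ 3`, `X_{C_n}(x,t)` is e-unimodal and palindromic with
center of symmetry `n/2`. -/
theorem chromatic_cycle_odd_eUnimodal (n k : ℕ) (hodd : Odd n) (hn : 3 ≤ n) (hk : 1 ≤ k) :
    EUnimodal ℤ (XCyc ℤ n k) ∧ PalinZ (XCyc ℤ n k) (n : ℤ) := by
  have h := (cone_rec (cw Polynomial.X (xv k) k) (cw_rec k) n).1 hodd
  rw [← XCyc_eq n k (by omega)] at h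
  exact ⟨h.unimodal, h.palin⟩

end
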